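/- arXiv:math/0106098 — 6 statements merged into one kernel-verified Lean document; each statement's English description precedes it below -/
import Mathlib

section
/- In quasi-set theory Q, if x and y are indistinguishable m-atoms, then the generalized ordered pairs ⟨x,y⟩ and ⟨y,x⟩ are extensionally identical (both being extensionally identical to [[x]]); consequently, for every relation R, ⟨x,y⟩ ∈ R entails that an element extensionally identical to ⟨y,x⟩ belongs to R, so no asymmetric relation—and hence no partial, total, or strict order—can be defined on a pure qset whose elements are indistinguishable from one another. -/
/-- A model of the quasi-set theory `Q`: a domain with predicates for m-atoms,
M-atoms and sets, indistinguishability `≡`, membership `∈`, a quasi-cardinal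
function, and (Skolemized) term-forming operations, satisfying the axioms of `Q`. -/
structure QST where
  /-- the domain -/
  U : Type
  /-- `m x` : `x` is an m-atom -/
  m : U → Prop
  /-- `Matom x` : `x` is an M-atom -/
  Matom : U → Prop
  /-- `Z x` : `x` is a set -/
  Z : U → Prop
  /-- indistinguishability `≡` -/
  ind : U → U → Prop
  /-- membership `∈` -/
  mem : U → U → Prop
  /-- the quasi-cardinal (cardinal-valued) -/
  qc : U → Cardinal.{0}
  /-- the empty qset (axiom Q10) -/
  emptyq : U
  /-- the weak pair `[x,y]` (axiom Q12); the weak singleton is `[x] := pair x x` -/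
  pair : U → U → U
  /-- binary union (from axiom Q14) -/
  union : U → U → U
  /-- difference `x − y = [t ∈ x : t ∉ y]` (separation, axiom Q13) -/
  diff : U → U → U
  /-- `cls x a` : the equivalence class `[t ∈ x : t ≡ a]` (separation, axiom Q13) -/
  cls : U → U → U
  /-- the power-qset `𝒫 x` (axiom Q15) -/
  pow : U → U
  /-- `Su u := [s ∈ 𝒫([u]) : u ∈ s]` for an m-atom `u` -/
  Su : U → U
  /-- `star u = u*`, the intersection of all members of `S_u` -/
  star : U → U
  -- Q1–Q3 : `≡` is an equivalence relation
  ind_refl : ∀ x, ind x x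
  ind_symm : ∀ x y, ind x y → ind y x
  ind_trans : ∀ x y z, ind x y → ind y z → ind x z
  -- Q4 : substitutivity of extensional identity `=_E` (atomic instances)
  q4_memL : ∀ x y z,
    ((¬(m x ∨ Matom x) ∧ ¬(m y ∨ Matom y) ∧ ∀ w, mem w x ↔ mem w y) ∨
      (Matom x ∧ Matom y ∧ ∀ w, ¬(m w ∨ Matom w) → (mem x w ↔ mem y w))) →
    mem x z → mem y z
  q4_memR : ∀ x y z,
    ((¬(m x ∨ Matom x) ∧ ¬(m y ∨ Matom y) ∧ ∀ w, mem w x ↔ mem w y) ∨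
      (Matom x ∧ Matom y ∧ ∀ w, ¬(m w ∨ Matom w) → (mem x w ↔ mem y w))) →
    mem z x → mem z y
  q4_qc : ∀ x y,
    ((¬(m x ∨ Matom x) ∧ ¬(m y ∨ Matom y) ∧ ∀ w, mem w x ↔ mem w y) ∨
      (Matom x ∧ Matom y ∧ ∀ w, ¬(m w ∨ Matom w) → (mem x w ↔ mem y w))) →
    qc x = qc y
  -- Q6 : the atoms are empty
  q6 : ∀ x y, mem x y → ¬(m y ∨ Matom y)
  -- Q8 : qsets of classical things are sets and conversely
  q8 : ∀ x, ¬(m x ∨ Matom x) → ((∀ y, mem y x → (Matom y ∨ Z y)) ↔ Z x)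
  -- Q9 (m-atom part)
  q9 : ∀ x y, m x → ind x y → m y
  -- Q10 : the empty qset
  emptyq_qset : ¬(m emptyq ∨ Matom emptyq)
  not_mem_emptyq : ∀ y, ¬ mem y emptyq
  -- Q12 : weak pair
  pair_qset : ∀ x y, ¬(m (pair x y) ∨ Matom (pair x y))
  mem_pair : ∀ x y t, mem t (pair x y) ↔ (ind t x ∨ ind t y)
  -- Q13 : separation instances (difference and ≡-classes)
  diff_qset : ∀ x y, ¬(m (diff x y) ∨ Matom (diff x y))
  mem_diff : ∀ x y, ¬(m x ∨ Matom x) →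
    ∀ t, (mem t (diff x y) ↔ (mem t x ∧ ¬ mem t y))
  cls_qset : ∀ x a, ¬(m (cls x a) ∨ Matom (cls x a))
  mem_cls : ∀ x a, ¬(m x ∨ Matom x) →
    ∀ t, (mem t (cls x a) ↔ (mem t x ∧ ind t a))
  -- Q14 : (binary) union
  union_qset : ∀ x y, ¬(m (union x y) ∨ Matom (union x y))
  mem_union : ∀ x y, ¬(m x ∨ Matom x) → ¬(m y ∨ Matom y) →
    ∀ t, (mem t (union x y) ↔ (mem t x ∨ mem t y))
  -- Q15 : power-qset
  pow_qset : ∀ x, ¬(m (pow x) ∨ Matom (pow x))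
  mem_pow : ∀ x, ¬(m x ∨ Matom x) →
    ∀ t, (mem t (pow x) ↔ ∀ z, mem z t → mem z x)
  -- `S_u` and `u*` for m-atoms `u`
  Su_qset : ∀ u, ¬(m (Su u) ∨ Matom (Su u))
  mem_Su : ∀ u, m u → ∀ s, (mem s (Su u) ↔ (mem s (pow (pair u u)) ∧ mem u s))
  star_qset : ∀ u, ¬(m (star u) ∨ Matom (star u))
  mem_star : ∀ u, m u → ∀ z, (mem z (star u) ↔
    ((∃ t, mem t (Su u) ∧ mem z t) ∧ ∀ s, mem s (Su u) → mem z s))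
  -- Q20 : nonempty qsets have nonzero quasi-cardinal
  q20 : ∀ x, ¬(m x ∨ Matom x) → (∃ y, mem y x) → qc x ≠ 0
  -- Q21 : subqsets of every smaller quasi-cardinality exist
  q21 : ∀ x, ¬(m x ∨ Matom x) → ∀ β : Cardinal.{0}, β ≤ qc x →
    ∃ y, ¬(m y ∨ Matom y) ∧ (∀ z, mem z y → mem z x) ∧ qc y = β
  -- Q24 : quasi-cardinal of a disjoint union
  q24 : ∀ x y, ¬(m x ∨ Matom x) → ¬(m y ∨ Matom y) →
    (∀ w, ¬(mem w x ∧ mem w y)) → qc (union x y) = qc x + qc y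
  -- Q26 : weak extensionality
  q26 : ∀ x y, ¬(m x ∨ Matom x) → ¬(m y ∨ Matom y) →
    (∀ a, mem a x → ∃ b, mem b y ∧
      (∀ z t, mem z (cls x a) → mem t (cls y b) → ind z t) ∧
      qc (cls x a) = qc (cls y b)) →
    (∀ b, mem b y → ∃ a, mem a x ∧
      (∀ z t, mem z (cls y b) → mem t (cls x a) → ind z t) ∧
      qc (cls y b) = qc (cls x a)) →
    ind x y

namespace QST

variable (T : QST)

/-- `Q(x)` : `x` is a qset. -/
def Qset (x : T.U) : Prop := ¬ (T.m x ∨ T.Matom x)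

/-- `x ⊆ y`. -/
def subq (x y : T.U) : Prop := ∀ z, T.mem z x → T.mem z y

/-- Extensional identity `x =_E y`. -/
def eqE (x y : T.U) : Prop :=
  (T.Qset x ∧ T.Qset y ∧ ∀ z, T.mem z x ↔ T.mem z y) ∨
  (T.Matom x ∧ T.Matom y ∧ ∀ z, T.Qset z → (T.mem x z ↔ T.mem y z))

/-- `Sim x y` : every element of `x` is indistinguishable from every element of `y`. -/
def Sim (x y : T.U) : Prop := ∀ z t, T.mem z x → T.mem t y → T.ind z t

/-- `QSim x y` : `Sim x y` and `qc x = qc y`. -/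
def QSim (x y : T.U) : Prop := T.Sim x y ∧ T.qc x = T.qc y

/-- `x'` is a strong singleton of `x` : `x' ⊆ [x]` and `qc x' = 1`. -/
def StrongSingleton (x x' : T.U) : Prop :=
  T.Qset x' ∧ T.subq x' (T.pair x x) ∧ T.qc x' = 1

/-- The generalized ordered pair `⟨x,y⟩ := [[x],[x,y]]`. -/
def opair (x y : T.U) : T.U := T.pair (T.pair x x) (T.pair x y)

/-- A pure qset: all its elements are m-atoms, pairwise indistinguishable. -/
def PureQset (x : T.U) : Prop :=
  T.Qset x ∧ (∀ y, T.mem y x → T.m y) ∧ ∀ y z, T.mem y x → T.mem z x → T.ind y z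

end QST

namespace QST

variable {T : QST}

lemma eqE_of_mem_iff {x y : T.U} (hx : T.Qset x) (hy : T.Qset y)
    (h : ∀ z, T.mem z x ↔ T.mem z y) : T.eqE x y :=
  Or.inl ⟨hx, hy, h⟩

lemma cls_eqE_cls {x y a : T.U} (hx : T.Qset x) (hy : T.Qset y)
    (h : ∀ z, T.mem z x ↔ T.mem z y) : T.eqE (T.cls x a) (T.cls y a) :=
  eqE_of_mem_iff (T.cls_qset x a) (T.cls_qset y a) fun z => by
    rw [T.mem_cls x a hx, T.mem_cls y a hy, h]

lemma ind_of_mem_iff {x y : T.U} (hx : T.Qset x) (hy : T.Qset y)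
    (h : ∀ z, T.mem z x ↔ T.mem z y) : T.ind x y := by
  have key : ∀ {x y : T.U}, T.Qset x → T.Qset y → (∀ z, T.mem z x ↔ T.mem z y) →
      ∀ a, T.mem a x → ∃ b, T.mem b y ∧
        (∀ z t, T.mem z (T.cls x a) → T.mem t (T.cls y b) → T.ind z t) ∧
        T.qc (T.cls x a) = T.qc (T.cls y b) := by
    intro x y hx hy h a ha
    refine ⟨a, (h a).1 ha, fun z t hz ht => ?_, T.q4_qc _ _ (cls_eqE_cls hx hy h)⟩
    exact T.ind_trans _ _ _ ((T.mem_cls x a hx z).1 hz).2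
      (T.ind_symm _ _ ((T.mem_cls y a hy t).1 ht).2)
  exact T.q26 x y hx hy (key hx hy h) (key hy hx fun z => (h z).symm)

lemma mem_pair_congr {x y x' y' : T.U} (hx : T.ind x x') (hy : T.ind y y') (t : T.U) :
    T.mem t (T.pair x y) ↔ T.mem t (T.pair x' y') := by
  rw [T.mem_pair, T.mem_pair]
  exact or_congr
    ⟨fun h => T.ind_trans _ _ _ h hx, fun h => T.ind_trans _ _ _ h (T.ind_symm _ _ hx)⟩
    ⟨fun h => T.ind_trans _ _ _ h hy, fun h => T.ind_trans _ _ _ h (T.ind_symm _ _ hy)⟩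

lemma pair_ind_pair {x y x' y' : T.U} (hx : T.ind x x') (hy : T.ind y y') :
    T.ind (T.pair x y) (T.pair x' y') :=
  ind_of_mem_iff (T.pair_qset x y) (T.pair_qset x' y') (mem_pair_congr hx hy)

lemma pair_eqE_pair {x y x' y' : T.U} (hx : T.ind x x') (hy : T.ind y y') :
    T.eqE (T.pair x y) (T.pair x' y') :=
  eqE_of_mem_iff (T.pair_qset x y) (T.pair_qset x' y') (mem_pair_congr hx hy)

lemma opair_eqE_opair {x y x' y' : T.U} (hx : T.ind x x') (hy : T.ind y y') :
    T.eqE (T.opair x y) (T.opair x' y') :=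
  pair_eqE_pair (pair_ind_pair hx hx) (pair_ind_pair hx hy)

end QST

/-- If `x` and `y` are indistinguishable m-atoms, then `⟨x,y⟩` and `⟨y,x⟩`
are extensionally identical (both being extensionally identical to `[[x]]`); consequently,
for every relation `R`, `⟨x,y⟩ ∈ R` entails that an element extensionally identical to
`⟨y,x⟩` belongs to `R`, so no asymmetric relation can be defined on a pure qset whose
elements are indistinguishable from one another. -/
theorem stmt2 (T : QST) :
    (∀ x y, T.m x → T.m y → T.ind x y →
      T.eqE (T.opair x y) (T.pair (T.pair x x) (T.pair x x)) ∧
      T.eqE (T.opair y x) (T.pair (T.pair x x) (T.pair x x)) ∧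
      T.eqE (T.opair x y) (T.opair y x) ∧
      ∀ R, T.mem (T.opair x y) R → ∃ p, T.eqE p (T.opair y x) ∧ T.mem p R) ∧
    (∀ P, T.PureQset P → ∀ R, T.Qset R →
      (∀ u v, T.mem u P → T.mem v P → T.mem (T.opair u v) R →
        ∀ p, T.eqE p (T.opair v u) → ¬ T.mem p R) →
      ∀ u v, T.mem u P → T.mem v P → ¬ T.mem (T.opair u v) R) := by
  refine ⟨fun x y _ _ hxy => ?_, fun P hP R _ hR u v hu hv huv => ?_⟩
  · have hyx := T.ind_symm _ _ hxy
    have hswap : T.eqE (T.opair x y) (T.opair y x) := QST.opair_eqE_opair hxy hyx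
    exact ⟨QST.opair_eqE_opair (T.ind_refl x) hyx, QST.opair_eqE_opair hyx (T.ind_refl x),
      hswap, fun R hR => ⟨_, hswap, hR⟩⟩
  · have huv' := hP.2.2 u v hu hv
    exact hR u v hu hv huv _ (QST.opair_eqE_opair huv' (T.ind_symm _ _ huv')) huv
end

section
/- In quasi-set theory Q, for every x there exists a strong singleton of x, i.e., a qset x' with x' ⊆ [x] and qc(x') = 1. -/
/-- In quasi-set theory `Q`, for every `x` there exists a strong singleton
of `x`, i.e., a qset `x'` with `x' ⊆ [x]` and `qc x' = 1`. -/
theorem stmt5 (T : QST) (x : T.U) :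
    ∃ x', T.StrongSingleton x x' := by
  exact T.q21 (T.pair x x) (T.pair_qset x x) 1 <|
    Cardinal.one_le_iff_ne_zero.mpr <|
      T.q20 _ (T.pair_qset x x) ⟨x, (T.mem_pair x x x).mpr (.inl (T.ind_refl x))⟩
end

section
/- In quasi-set theory Q, all strong singletons of x are indistinguishable: if x' and x'' are both strong singletons of x, then x' ≡ x''. -/
namespace QST

theorem qc_congr (T : QST) {x y : T.U} (hx : T.Qset x) (hy : T.Qset y)
    (h : ∀ w, T.mem w x ↔ T.mem w y) : T.qc x = T.qc y :=
  T.q4_qc x y (Or.inl ⟨hx, hy, h⟩)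

/-- A qset of quasi-cardinal one is nonempty: an empty qset is disjoint from itself, so its
quasi-cardinal equals its own double. -/
theorem exists_mem_of_qc_eq_one (T : QST) {x : T.U} (hx : T.Qset x) (h : T.qc x = 1) :
    ∃ a, T.mem a x := by
  by_contra! hempty
  have hunion : T.qc (T.union x x) = T.qc x :=
    T.qc_congr (T.union_qset x x) hx fun w => by rw [T.mem_union x x hx hx, or_self]
  rw [T.q24 x x hx hx fun w hw => hempty w hw.1, h] at hunion
  exact absurd hunion (by exact_mod_cast (by decide : (1 + 1 : ℕ) ≠ 1))

theorem StrongSingleton.ind_of_mem {T : QST} {x x' a : T.U} (h : T.StrongSingleton x x')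
    (ha : T.mem a x') : T.ind a x :=
  or_self_iff.1 ((T.mem_pair x x a).1 (h.2.1 a ha))

theorem StrongSingleton.qc_cls {T : QST} {x x' a : T.U} (h : T.StrongSingleton x x')
    (ha : T.mem a x') : T.qc (T.cls x' a) = 1 := by
  rw [← h.2.2]
  refine T.qc_congr (T.cls_qset x' a) h.1 fun w => ?_
  rw [T.mem_cls x' a h.1]
  exact and_iff_left_of_imp fun hw =>
    T.ind_trans _ _ _ (h.ind_of_mem hw) (T.ind_symm _ _ (h.ind_of_mem ha))

theorem StrongSingleton.exists_similar_cls {T : QST} {x x' x'' : T.U}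
    (h' : T.StrongSingleton x x') (h'' : T.StrongSingleton x x'') (a : T.U) (ha : T.mem a x') :
    ∃ b, T.mem b x'' ∧ T.QSim (T.cls x' a) (T.cls x'' b) := by
  obtain ⟨b, hb⟩ := T.exists_mem_of_qc_eq_one h''.1 h''.2.2
  refine ⟨b, hb, fun z t hz ht => ?_, by rw [h'.qc_cls ha, h''.qc_cls hb]⟩
  have hz' := h'.ind_of_mem ((T.mem_cls x' a h'.1 z).1 hz).1
  have ht' := h''.ind_of_mem ((T.mem_cls x'' b h''.1 t).1 ht).1
  exact T.ind_trans _ _ _ hz' (T.ind_symm _ _ ht')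

end QST

/-- In quasi-set theory `Q`, all strong singletons of `x` are
indistinguishable. -/
theorem stmt6 (T : QST) (x x' x'' : T.U)
    (h' : T.StrongSingleton x x') (h'' : T.StrongSingleton x x'') :
    T.ind x' x'' := by
  exact T.q26 x' x'' h'.1 h''.1 (h'.exists_similar_cls h'') (h''.exists_similar_cls h')
end

section
/- In quasi-set theory Q, for all qsets x and y, if y ⊆ x then qc(x − y) = qc(x) − qc(y). -/
/-- In quasi-set theory `Q`, for all qsets `x` and `y`, if `y ⊆ x` then
`qc (x − y) = qc x − qc y` (stated in the subtraction-free form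
`qc (x − y) + qc y = qc x`, as quasi-cardinals are cardinals). -/
theorem stmt7 (T : QST) (x y : T.U) (hx : T.Qset x) (hy : T.Qset y)
    (hsub : T.subq y x) :
    T.qc (T.diff x y) + T.qc y = T.qc x := by
  have hd : T.Qset (T.diff x y) := T.diff_qset x y
  have hdisj : ∀ w, ¬(T.mem w (T.diff x y) ∧ T.mem w y) := fun w hw =>
    ((T.mem_diff x y hx w).1 hw.1).2 hw.2
  rw [← T.q24 _ _ hd hy hdisj]
  refine T.q4_qc _ _ (Or.inl ⟨T.union_qset _ _, hx, fun w => ?_⟩)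
  rw [T.mem_union _ _ hd hy, T.mem_diff x y hx]
  have := hsub w
  tauto
end

section
/- In quasi-set theory Q, if u is an m-atom and z is a qset with z ⊆ u* and qc(z) = 1, then either u ∈ u* − z or qc(u*) = 1. -/
namespace QST

theorem mem_Su_iff (T : QST) {u : T.U} (hu : T.m u) (s : T.U) :
    T.mem s (T.Su u) ↔ T.subq s (T.pair u u) ∧ T.mem u s := by
  rw [T.mem_Su u hu, T.mem_pow _ (T.pair_qset u u), subq]

theorem pair_self_mem_Su (T : QST) {u : T.U} (hu : T.m u) :
    T.mem (T.pair u u) (T.Su u) :=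
  (T.mem_Su_iff hu _).2 ⟨fun _ h => h, (T.mem_pair u u u).2 (.inl (T.ind_refl u))⟩

theorem mem_star_self (T : QST) {u : T.U} (hu : T.m u) : T.mem u (T.star u) :=
  (T.mem_star u hu u).2
    ⟨⟨_, T.pair_self_mem_Su hu, ((T.mem_Su_iff hu _).1 (T.pair_self_mem_Su hu)).2⟩,
      fun s hs => ((T.mem_Su_iff hu s).1 hs).2⟩

theorem star_subq (T : QST) {u s : T.U} (hu : T.m u) (hs : T.mem s (T.Su u)) :
    T.subq (T.star u) s :=
  fun w hw => ((T.mem_star u hu w).1 hw).2 s hs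

end QST

/-- In quasi-set theory `Q`, if `u` is an m-atom and `z` is a qset with
`z ⊆ u*` and `qc z = 1`, then either `u ∈ u* − z` or `qc u* = 1`. -/
theorem stmt9 (T : QST) (u z : T.U) (hu : T.m u) (hz : T.Qset z)
    (hsub : T.subq z (T.star u)) (hqc : T.qc z = 1) :
    T.mem u (T.diff (T.star u) z) ∨ T.qc (T.star u) = 1 := by
  by_cases huz : T.mem u z
  · have hzS : T.mem z (T.Su u) := (T.mem_Su_iff hu z).2
      ⟨fun w hw => T.star_subq hu (T.pair_self_mem_Su hu) w (hsub w hw), huz⟩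
    right
    rw [← hqc]
    exact T.q4_qc _ _ (.inl ⟨T.star_qset u, hz, fun w => ⟨T.star_subq hu hzS w, hsub w⟩⟩)
  · exact .inl ((T.mem_diff _ z (T.star_qset u) u).2 ⟨T.mem_star_self hu, huz⟩)
end

section
/- In quasi-set theory Q, for every m-atom u, qc(u*) = 1; that is, u* is a strong singleton of u. -/
namespace QST

/-- Extensionally equal qsets have the same quasi-cardinal. -/
theorem qc_eq_of_mem_iff (T : QST) {x y : T.U} (hx : T.Qset x) (hy : T.Qset y)
    (h : ∀ z, T.mem z x ↔ T.mem z y) : T.qc x = T.qc y :=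
  T.q4_qc x y (Or.inl ⟨hx, hy, h⟩)

/-- A qset without elements has quasi-cardinal zero. -/
theorem qc_eq_zero_of_forall_not_mem (T : QST) {x : T.U} (hx : T.Qset x)
    (h : ∀ z, ¬ T.mem z x) : T.qc x = 0 := by
  obtain ⟨y, hy, hyx, hqc⟩ := T.q21 x hx 0 zero_le
  rw [← hqc]
  exact T.qc_eq_of_mem_iff hx hy fun z => ⟨fun hz => (h z hz).elim, hyx z⟩

theorem star_subq_pair (T : QST) {u : T.U} (hu : T.m u) :
    T.subq (T.star u) (T.pair u u) := by
  intro z hz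
  obtain ⟨⟨t, ht, hzt⟩, -⟩ := (T.mem_star u hu z).1 hz
  exact ((T.mem_Su_iff hu t).1 ht).1 z hzt

/-- `u*` is the least subqset of `u*` containing `u`. -/
theorem star_subq_of_mem (T : QST) {u s : T.U} (hu : T.m u)
    (hs : T.subq s (T.star u)) (hus : T.mem u s) : T.subq (T.star u) s := fun z hz =>
  ((T.mem_star u hu z).1 hz).2 s
    ((T.mem_Su_iff hu s).2 ⟨fun w hw => T.star_subq_pair hu w (hs w hw), hus⟩)

theorem qc_star (T : QST) {u : T.U} (hu : T.m u) : T.qc (T.star u) = 1 := by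
  have hstar : T.Qset (T.star u) := T.star_qset u
  have hne : T.qc (T.star u) ≠ 0 := T.q20 _ hstar ⟨u, T.mem_star_self hu⟩
  obtain ⟨y, hy, hys, hqc⟩ := T.q21 _ hstar 1 (Cardinal.one_le_iff_ne_zero.2 hne)
  by_cases huy : T.mem u y
  · rw [← hqc]
    exact T.qc_eq_of_mem_iff hstar hy fun z => ⟨T.star_subq_of_mem hu hys huy z, hys z⟩
  · have hdiff := T.mem_diff (T.star u) y hstar
    have hsub : T.subq (T.star u) (T.diff (T.star u) y) :=
      T.star_subq_of_mem hu (fun z hz => ((hdiff z).1 hz).1)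
        ((hdiff u).2 ⟨T.mem_star_self hu, huy⟩)
    have hzero : T.qc y = 0 := T.qc_eq_zero_of_forall_not_mem hy fun z hz =>
      ((hdiff z).1 (hsub z (hys z hz))).2 hz
    exact absurd (hqc.symm.trans hzero) one_ne_zero

end QST

/-- In quasi-set theory `Q`, for every m-atom `u`, `qc u* = 1`; that is,
`u*` is a strong singleton of `u`. -/
theorem stmt10 (T : QST) (u : T.U) (hu : T.m u) :
    T.qc (T.star u) = 1 ∧ T.StrongSingleton u (T.star u) := by
  exact ⟨T.qc_star hu, T.star_qset u, T.star_subq_pair hu, T.qc_star hu⟩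
end
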